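/- Let G be a 2-connected o-heavy non-Hamiltonian graph on n vertices, C a longest heavy cycle of G with a fixed orientation, R a component of G − V(C), and v_i, v_j distinct neighbors of R on C. Then {v_i⁻, v_i⁺} ∈ Ẽ(G) and {v_j⁻, v_j⁺} ∈ Ẽ(G); moreover at least one of v_i⁻v_i⁺ and v_j⁻v_j⁺ is an actual edge of G. -/

import Mathlib

open SimpleGraph

/-- `{x, y}` is an Ore-edge of `G`: either an actual edge, or a pair of distinct
vertices with degree sum at least `n`. -/
def OreEdge {V : Type*} [Fintype V] (G : SimpleGraph V) [DecidableRel G.Adj]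
    (x y : V) : Prop :=
  x ≠ y ∧ (G.Adj x y ∨ Fintype.card V ≤ G.degree x + G.degree y)

/-- The cycle `C = f 0, f 1, …, f (m-1), f 0` in `G`, with the orientation given
by increasing indices (so `f (i+1)` is the successor and `f (i-1)` the
predecessor of `f i` on `C`). -/
def IsCycleEmbedding {V : Type*} (G : SimpleGraph V) (m : ℕ) (f : ZMod m → V) : Prop :=
  3 ≤ m ∧ Function.Injective f ∧ ∀ i : ZMod m, G.Adj (f i) (f (i + 1))

/-- `f` describes a longest cycle of `G` (of length `m`). -/
def IsLongestCycle {V : Type*} (G : SimpleGraph V) (m : ℕ) (f : ZMod m → V) : Prop :=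
  IsCycleEmbedding G m f ∧
  ∀ (u : V) (C : G.Walk u u), C.IsCycle → C.length ≤ m

/-- `R` is a connected component of `G - V(C)`, where `C` is the cycle given
by `f`: `R` is a nonempty set of vertices off `C`, connected in the induced
subgraph, and closed under adjacency to vertices off `C`. -/
def IsComponentOutside {V : Type*} (G : SimpleGraph V) (m : ℕ) (f : ZMod m → V)
    (R : Set V) : Prop :=
  R.Nonempty ∧ (∀ x ∈ R, x ∉ Set.range f) ∧ (G.induce R).Connected ∧
  ∀ x ∈ R, ∀ y : V, G.Adj x y → y ∉ Set.range f → y ∈ R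

/-- `G` is 2-connected. -/
def TwoConnected {V : Type*} [Fintype V] (G : SimpleGraph V) : Prop :=
  3 ≤ Fintype.card V ∧ ∀ v : V, (G.induce {w | w ≠ v}).Connected

/-- `c, a, b, d` form an induced claw in `G` with center `c`. -/
def IsInducedClaw {V : Type*} (G : SimpleGraph V) (c a b d : V) : Prop :=
  a ≠ b ∧ a ≠ d ∧ b ≠ d ∧
  G.Adj c a ∧ G.Adj c b ∧ G.Adj c d ∧
  ¬G.Adj a b ∧ ¬G.Adj a d ∧ ¬G.Adj b d

/-- `G` is o-heavy. -/
def OHeavy {V : Type*} [Fintype V] (G : SimpleGraph V) [DecidableRel G.Adj] : Prop :=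
  ∀ c a b d : V, IsInducedClaw G c a b d →
    Fintype.card V ≤ G.degree a + G.degree b ∨
    Fintype.card V ≤ G.degree a + G.degree d ∨
    Fintype.card V ≤ G.degree b + G.degree d

/-- A path with at least three vertices and adjacent ends closes up to a cycle. -/
theorem exists_isCycle_of_isChain {V : Type*} {G : SimpleGraph V} {l : List V} {a b : V}
    (hc : l.IsChain G.Adj) (hn : l.Nodup) (hl : 3 ≤ l.length)
    (ha : l.head? = some a) (hb : l.getLast? = some b) (hab : G.Adj a b) :
    ∃ (u : V) (C : G.Walk u u), C.IsCycle ∧ C.length = l.length := by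
  match l, hl with
  | x :: y :: z :: t, _ =>
    obtain rfl : x = a := by simpa using ha
    obtain rfl : (z :: t).getLast (by simp) = b := by
      rw [← Option.some_inj, ← List.getLast?_eq_some_getLast]
      simpa using hb
    have hc' : (y :: z :: t).IsChain G.Adj := hc.of_cons
    let p : G.Walk y ((z :: t).getLast (by simp)) := Walk.ofSupport (y :: z :: t) (by simp) hc'
    have hp : p.support = y :: z :: t := Walk.support_ofSupport _ hc'
    have hxp : x ∉ p.support := by rw [hp]; exact (List.nodup_cons.1 hn).1
    have hpp : p.IsPath := by rw [Walk.isPath_def, hp]; exact (List.nodup_cons.1 hn).2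
    refine ⟨_, Walk.cons hab.symm (Walk.cons hc.rel p), ?_, ?_⟩
    · rw [Walk.cons_isCycle_iff]
      refine ⟨hpp.cons hxp, ?_⟩
      rw [Walk.edges_cons, List.mem_cons, not_or]
      refine ⟨fun h => ?_, fun h => hxp (p.snd_mem_support_of_mem_edges h)⟩
      have hy : (z :: t).getLast (by simp) = y := by
        rw [Sym2.eq_swap] at h
        exact Sym2.congr_right.1 h
      have hyn : y ∉ z :: t := (List.nodup_cons.1 (List.nodup_cons.1 hn).2).1
      exact hyn (hy ▸ List.getLast_mem (by simp))
    · have := congrArg List.length hp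
      rw [Walk.length_support] at this
      simp only [Walk.length_cons, List.length_cons] at *
      omega

/-- If the ends of a path with at least three vertices form an Ore-edge, some cycle is at least
as long as the path has vertices. -/
theorem OreEdge.exists_isCycle {V : Type*} [Fintype V] [DecidableEq V]
    {G : SimpleGraph V} [DecidableRel G.Adj] {l : List V} {a b : V} (hab : OreEdge G a b)
    (hc : l.IsChain G.Adj) (hn : l.Nodup) (hl : 3 ≤ l.length)
    (ha : l.head? = some a) (hb : l.getLast? = some b) :
    ∃ (u : V) (C : G.Walk u u), C.IsCycle ∧ l.length ≤ C.length := by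
  by_cases hadj : G.Adj a b
  · obtain ⟨u, C, hC, h⟩ := exists_isCycle_of_isChain hc hn hl ha hb hadj
    exact ⟨u, C, hC, h.ge⟩
  have hdeg : Fintype.card V ≤ G.degree a + G.degree b := hab.2.resolve_left hadj
  have ha0 : l[0]'(by omega) = a := by
    rw [List.head?_eq_getElem?, List.getElem?_eq_some_iff] at ha
    exact ha.2
  have hbl : l[l.length - 1]'(by omega) = b := by
    rw [List.getLast?_eq_getElem?, List.getElem?_eq_some_iff] at hb
    exact hb.2
  let φ : V → V := fun c => if h : c ∈ l then
    l[l.idxOf c - 1]'(by have := List.idxOf_lt_length_of_mem h; omega) else c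
  have hφ : ∀ c ∈ G.neighborFinset a, ∀ h : c ∈ l, ∃ (k : ℕ) (hk : k + 1 < l.length),
      l[k + 1] = c ∧ φ c = l[k] := by
    intro c hca h
    have hlt := List.idxOf_lt_length_of_mem h
    have hget : l[l.idxOf c] = c := List.getElem_idxOf hlt
    have h0 : l.idxOf c ≠ 0 := by
      intro h0
      have : c = a := by rw [← hget, ← ha0]; simp only [h0]
      subst this
      simp at hca
    refine ⟨l.idxOf c - 1, by omega, ?_, by simp [φ, h]⟩
    simpa only [Nat.sub_add_cancel (Nat.pos_of_ne_zero h0)] using hget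
  have hφl : ∀ c, c ∉ l → φ c = c := fun c h => by simp [φ, h]
  have hφmem : ∀ c ∈ G.neighborFinset a, (φ c ∈ l ↔ c ∈ l) := by
    intro c hca
    by_cases h : c ∈ l
    · obtain ⟨k, hk, -, h2⟩ := hφ c hca h
      simp [h, h2]
    · simp [h, hφl c h]
  have hinj : Set.InjOn φ (G.neighborFinset a) := by
    intro c hca d hda hcd
    rw [Finset.mem_coe] at hca hda
    by_cases h : c ∈ l
    · have hd : d ∈ l := by rwa [← hφmem d hda, ← hcd, hφmem c hca]
      obtain ⟨k, hk, hk1, hk2⟩ := hφ c hca h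
      obtain ⟨k', hk', hk1', hk2'⟩ := hφ d hda hd
      have : k = k' := by
        rw [hk2, hk2'] at hcd
        exact (hn.getElem_inj_iff).1 hcd
      subst this
      rw [← hk1, ← hk1']
    · have hd : d ∉ l := by rwa [← hφmem d hda, ← hcd, hφmem c hca]
      rwa [hφl c h, hφl d hd] at hcd
  have hA : ∀ z ∈ (G.neighborFinset a).image φ, z ≠ b := by
    intro z hz hzb
    obtain ⟨c, hca, rfl⟩ := Finset.mem_image.1 hz
    have hbmem : b ∈ l := List.mem_of_getLast? hb
    have hcl : c ∈ l := by rwa [← hφmem c hca, hzb]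
    obtain ⟨k, hk, hk1, hk2⟩ := hφ c hca hcl
    rw [hk2, ← hbl, hn.getElem_inj_iff] at hzb
    omega
  have hinter : ((G.neighborFinset a).image φ ∩ G.neighborFinset b).Nonempty := by
    rw [Finset.nonempty_iff_ne_empty]
    intro hempty
    have h1 := Finset.card_union_of_disjoint (Finset.disjoint_iff_inter_eq_empty.2 hempty)
    rw [Finset.card_image_of_injOn hinj, card_neighborFinset_eq_degree,
      card_neighborFinset_eq_degree] at h1
    have h2 : (G.neighborFinset a).image φ ∪ G.neighborFinset b ⊆ Finset.univ.erase b := by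
      intro z hz
      rw [Finset.mem_erase]
      refine ⟨?_, Finset.mem_univ z⟩
      rcases Finset.mem_union.1 hz with hz | hz
      · exact hA z hz
      · rintro rfl
        simp at hz
    have h3 := Finset.card_le_card h2
    rw [Finset.card_erase_of_mem (Finset.mem_univ b), Finset.card_univ] at h3
    have : 0 < Fintype.card V := Fintype.card_pos_iff.2 ⟨b⟩
    omega
  obtain ⟨z, hz⟩ := hinter
  obtain ⟨hza, hzb⟩ := Finset.mem_inter.1 hz
  obtain ⟨c, hca, rfl⟩ := Finset.mem_image.1 hza
  have hac : G.Adj a c := (G.mem_neighborFinset a c).1 hca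
  rw [G.mem_neighborFinset] at hzb
  by_cases hcl : c ∈ l
  · obtain ⟨k, hk, hk1, hk2⟩ := hφ c hca hcl
    have hsplit := List.take_append_drop (k + 1) l
    have hperm : (l.take (k + 1) ++ (l.drop (k + 1)).reverse).Perm l := by
      conv_rhs => rw [← hsplit]
      exact (List.reverse_perm _).append_left _
    have hchain : (l.take (k + 1) ++ (l.drop (k + 1)).reverse).IsChain G.Adj := by
      rw [List.isChain_append]
      refine ⟨hc.take _, ?_, ?_⟩
      · rw [List.isChain_reverse]
        exact (hc.drop _).imp fun _ _ h => h.symm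
      · intro x hx y hy
        have hx' : x = l[k] := by
          rw [List.getLast?_take] at hx
          simp at hx
          grind
        have hy' : y = b := by
          rw [List.head?_reverse, List.getLast?_drop, if_neg (by omega), hb] at hy
          simpa using hy.symm
        rw [hx', hy', ← hk2]
        exact hzb.symm
    have hhead : (l.take (k + 1) ++ (l.drop (k + 1)).reverse).head? = some a := by
      rw [List.head?_append, List.head?_take, if_neg (by omega), ha]
      rfl
    have hlast : (l.take (k + 1) ++ (l.drop (k + 1)).reverse).getLast? = some c := by
      rw [List.getLast?_append, List.getLast?_reverse, List.head?_drop,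
        List.getElem?_eq_getElem hk, hk1]
      rfl
    obtain ⟨u, C, hC, h⟩ := exists_isCycle_of_isChain hchain (hperm.nodup_iff.2 hn)
      (by rwa [hperm.length_eq]) hhead hlast hac
    exact ⟨u, C, hC, by rw [h, hperm.length_eq]⟩
  · rw [hφl c hcl] at hzb
    have hchain : (c :: l).IsChain G.Adj := by
      rw [List.isChain_cons]
      refine ⟨fun y hy => ?_, hc⟩
      rw [ha] at hy
      obtain rfl : a = y := by simpa using hy
      exact hac.symm
    have hlast : (c :: l).getLast? = some b := by
      rw [List.getLast?_cons, hb]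
      rfl
    obtain ⟨u, C, hC, h⟩ := exists_isCycle_of_isChain hchain (List.nodup_cons.2 ⟨hcl, hn⟩)
      (by rw [List.length_cons]; omega) rfl hlast hzb.symm
    exact ⟨u, C, hC, by simp [h]⟩

/-- The ends of a path with more vertices than a longest cycle do not form an Ore-edge. -/
theorem IsLongestCycle.not_oreEdge {V : Type*} [Fintype V] [DecidableEq V]
    {G : SimpleGraph V} [DecidableRel G.Adj] {m : ℕ} {f : ZMod m → V}
    (hC : IsLongestCycle G m f) {l : List V} {a b : V}
    (hc : l.IsChain G.Adj) (hn : l.Nodup) (hl : m < l.length)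
    (ha : l.head? = some a) (hb : l.getLast? = some b) : ¬OreEdge G a b := by
  intro hab
  have h3 : 3 ≤ m := hC.1.1
  obtain ⟨u, C, hcyc, h⟩ := hab.exists_isCycle hc hn (by omega) ha hb
  have := hC.2 u C hcyc
  omega

/-- Reversing the orientation of a longest cycle. -/
theorem IsLongestCycle.neg {V : Type*} {G : SimpleGraph V} {m : ℕ} {f : ZMod m → V}
    (hC : IsLongestCycle G m f) : IsLongestCycle G m (fun k => f (-k)) := by
  obtain ⟨⟨h3, hinj, hadj⟩, hmax⟩ := hC
  refine ⟨⟨h3, hinj.comp neg_injective, fun k => ?_⟩, hmax⟩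
  have := hadj (-(k + 1))
  rw [show -(k + 1) + 1 = -k by ring] at this
  exact this.symm

theorem IsCycleEmbedding.isChain_forward {V : Type*} {G : SimpleGraph V} {m : ℕ} {f : ZMod m → V}
    (hC : IsCycleEmbedding G m f) (s : ZMod m) (d : ℕ) :
    ((List.range d).map fun k : ℕ => f (s + k)).IsChain G.Adj := by
  rw [List.isChain_map, List.isChain_range]
  intro k _
  have := hC.2.2 (s + k)
  rwa [add_assoc, ← Nat.cast_succ] at this

theorem IsCycleEmbedding.isChain_backward {V : Type*} {G : SimpleGraph V} {m : ℕ}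
    {f : ZMod m → V} (hC : IsCycleEmbedding G m f) (s : ZMod m) (d : ℕ) :
    ((List.range d).map fun k : ℕ => f (s - k)).IsChain G.Adj := by
  rw [List.isChain_map, List.isChain_range]
  intro k _
  have := hC.2.2 (s - (k.succ : ℕ))
  rw [show s - (k.succ : ℕ) + 1 = s - k by push_cast; ring] at this
  exact this.symm

theorem ZMod.eq_of_natCast_eq_of_lt {m a b : ℕ} (ha : a < m) (hb : b < m)
    (h : (a : ZMod m) = b) : a = b := by
  rw [ZMod.natCast_eq_natCast_iff'] at h
  rwa [Nat.mod_eq_of_lt ha, Nat.mod_eq_of_lt hb] at h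

/-- A vertex off a longest cycle does not form an Ore-edge with the successor of a neighbor. -/
theorem IsLongestCycle.not_oreEdge_succ {V : Type*} [Fintype V] [DecidableEq V]
    {G : SimpleGraph V} [DecidableRel G.Adj] {m : ℕ} {f : ZMod m → V}
    (hC : IsLongestCycle G m f) {i : ZMod m} {x : V} (hx : x ∉ Set.range f)
    (hix : G.Adj (f i) x) : ¬OreEdge G x (f (i + 1)) := by
  obtain ⟨h3, hinj, -⟩ := hC.1
  obtain ⟨d, rfl⟩ : ∃ d, m = d + 1 := ⟨m - 1, by omega⟩
  refine hC.not_oreEdge (l := x :: (List.range (d + 1)).map fun k : ℕ => f (i - k))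
    ?_ ?_ (by simp) rfl ?_
  · rw [List.isChain_cons]
    refine ⟨fun y hy => ?_, hC.1.isChain_backward i _⟩
    rw [List.range_succ_eq_map] at hy
    obtain rfl : f i = y := by simpa using hy
    exact hix.symm
  · rw [List.nodup_cons]
    refine ⟨fun h => ?_, ?_⟩
    · obtain ⟨k, -, rfl⟩ := List.mem_map.1 h
      exact hx ⟨_, rfl⟩
    · refine List.Nodup.map_on (fun a ha b hb hab => ?_) List.nodup_range
      exact ZMod.eq_of_natCast_eq_of_lt (List.mem_range.1 ha) (List.mem_range.1 hb)
        (sub_right_injective (hinj hab))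
  · have : i - (d : ZMod (d + 1)) = i + 1 := by
      have h := ZMod.natCast_self (d + 1)
      push_cast at h
      linear_combination -h
    rw [List.getLast?_cons, List.range_succ]
    simp [this]

/-- The successors of two distinct neighbors of a component off a longest cycle do not form an
Ore-edge. -/
theorem IsLongestCycle.not_oreEdge_succ_succ {V : Type*} [Fintype V] [DecidableEq V]
    {G : SimpleGraph V} [DecidableRel G.Adj] {m : ℕ} {f : ZMod m → V}
    (hC : IsLongestCycle G m f) {R : Set V} (hR : ∀ x ∈ R, x ∉ Set.range f)
    (hconn : (G.induce R).Connected) {i j : ZMod m} (hij : i ≠ j)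
    (hi : ∃ x ∈ R, G.Adj (f i) x) (hj : ∃ x ∈ R, G.Adj (f j) x) :
    ¬OreEdge G (f (i + 1)) (f (j + 1)) := by
  obtain ⟨h3, hinj, -⟩ := hC.1
  obtain ⟨x, hxR, hix⟩ := hi
  obtain ⟨y, hyR, hjy⟩ := hj
  obtain ⟨p, hp⟩ := (hconn.preconnected ⟨y, hyR⟩ ⟨x, hxR⟩).exists_isPath
  have : NeZero m := ⟨by omega⟩
  obtain ⟨d, hd⟩ : ∃ d, (j - i).val = d + 1 :=
    Nat.exists_eq_succ_of_ne_zero ((ZMod.val_ne_zero _).2 (sub_ne_zero.2 hij.symm))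
  have hdm : d + 1 < m := hd ▸ ZMod.val_lt _
  obtain ⟨e, he⟩ : ∃ e, m = (d + 1) + (e + 1) := ⟨m - (d + 1) - 1, by omega⟩
  have hdj : ((d : ℕ) : ZMod m) + 1 = j - i := by
    rw [← Nat.cast_succ, Nat.succ_eq_add_one, ← hd, ZMod.natCast_zmod_val]
  have hej : ((d : ℕ) : ZMod m) + 1 + (e + 1) = 0 := by
    have h : ((d + 1 + (e + 1) : ℕ) : ZMod m) = 0 := by rw [← he]; exact ZMod.natCast_self m
    exact_mod_cast h
  have hsupp : (p.support.map Subtype.val).IsChain G.Adj := by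
    rw [List.isChain_map]
    exact p.isChain_adj_support
  have hpR : ∀ z ∈ p.support.map Subtype.val, z ∈ R := by
    intro z hz
    obtain ⟨w, -, rfl⟩ := List.mem_map.1 hz
    exact w.2
  have hhead : (p.support.map Subtype.val).head? = some y := by
    rw [List.head?_map, List.head?_eq_some_head p.support_ne_nil, p.head_support]
    rfl
  have hlast : (p.support.map Subtype.val).getLast? = some x := by
    rw [List.getLast?_map, List.getLast?_eq_some_getLast p.support_ne_nil, p.getLast_support]
    rfl
  refine hC.not_oreEdge (l := ((List.range (d + 1)).map fun k : ℕ => f (i + 1 + k)) ++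
    (p.support.map Subtype.val ++ (List.range (e + 1)).map fun k : ℕ => f (i - k)))
    ?_ ?_ ?_ ?_ ?_
  · rw [List.isChain_append, List.isChain_append]
    refine ⟨hC.1.isChain_forward _ _, ⟨hsupp, hC.1.isChain_backward _ _, ?_⟩, ?_⟩
    · intro u hu v hv
      rw [hlast] at hu
      rw [List.range_succ_eq_map] at hv
      obtain rfl : x = u := by simpa using hu
      obtain rfl : f i = v := by simpa using hv
      exact hix.symm
    · intro u hu v hv
      rw [List.head?_append, hhead] at hv
      rw [List.range_succ] at hu
      obtain rfl : y = v := by simpa using hv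
      obtain rfl : f (i + 1 + d) = u := by simpa using hu
      rwa [show i + 1 + (d : ZMod m) = j by linear_combination hdj]
  · rw [List.nodup_append', List.nodup_append']
    refine ⟨?_, ⟨?_, ?_, ?_⟩, ?_⟩
    · refine List.Nodup.map_on (fun a ha b hb hab => ?_) List.nodup_range
      rw [List.mem_range] at ha hb
      exact ZMod.eq_of_natCast_eq_of_lt (by omega) (by omega) (add_right_injective _ (hinj hab))
    · exact (hp.support_nodup).map Subtype.val_injective
    · refine List.Nodup.map_on (fun a ha b hb hab => ?_) List.nodup_range
      rw [List.mem_range] at ha hb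
      exact ZMod.eq_of_natCast_eq_of_lt (by omega) (by omega) (sub_right_injective (hinj hab))
    · intro u hu hv
      obtain ⟨k, -, rfl⟩ := List.mem_map.1 hv
      exact hR _ (hpR _ hu) ⟨_, rfl⟩
    · intro u hu hv
      obtain ⟨k, hk, rfl⟩ := List.mem_map.1 hu
      rcases List.mem_append.1 hv with hv | hv
      · exact hR _ (hpR _ hv) ⟨_, rfl⟩
      · obtain ⟨k', hk', h⟩ := List.mem_map.1 hv
        rw [List.mem_range] at hk hk'
        have h' : ((k + 1 + k' : ℕ) : ZMod m) = (0 : ℕ) := by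
          push_cast
          linear_combination -(hinj h)
        have := ZMod.eq_of_natCast_eq_of_lt (by omega) (by omega) h'
        omega
  · have : 0 < p.support.length := List.length_pos_of_ne_nil p.support_ne_nil
    simp only [List.length_append, List.length_map, List.length_range]
    omega
  · rw [List.range_succ_eq_map]
    simp
  · rw [List.range_succ (n := e), ← List.append_assoc]
    have : i - (e : ZMod m) = j + 1 := by linear_combination hdj - hej
    simp [this]

/-- The neighbors along a longest cycle of an attachment vertex of an outside vertex form an
Ore-edge when `G` is o-heavy. -/
theorem IsLongestCycle.oreEdge_pred_succ {V : Type*} [Fintype V] [DecidableEq V]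
    {G : SimpleGraph V} [DecidableRel G.Adj] (hoh : OHeavy G) {m : ℕ} {f : ZMod m → V}
    (hC : IsLongestCycle G m f) {i : ZMod m} {x : V} (hx : x ∉ Set.range f)
    (hix : G.Adj (f i) x) : OreEdge G (f (i - 1)) (f (i + 1)) := by
  obtain ⟨h3, hinj, hadj⟩ := hC.1
  have hne : f (i - 1) ≠ f (i + 1) := by
    intro h
    have h' : ((2 : ℕ) : ZMod m) = (0 : ℕ) := by
      push_cast
      linear_combination -(hinj h)
    have := ZMod.eq_of_natCast_eq_of_lt (by omega) (by omega) h'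
    omega
  have hxne : ∀ k, x ≠ f k := fun k h => hx ⟨k, h.symm⟩
  have hsucc : ¬OreEdge G x (f (i + 1)) := hC.not_oreEdge_succ hx hix
  have hpred : ¬OreEdge G x (f (i - 1)) := by
    have h := hC.neg.not_oreEdge_succ (i := -i) (x := x)
      (by rintro ⟨k, hk⟩; exact hx ⟨_, hk⟩) (by simpa using hix)
    rwa [show -(-i + 1) = i - 1 by ring] at h
  refine ⟨hne, or_iff_not_imp_left.2 fun hna => ?_⟩
  have hpi : G.Adj (f i) (f (i - 1)) := by
    have := hadj (i - 1)
    rw [sub_add_cancel] at this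
    exact this.symm
  rcases hoh (f i) x (f (i - 1)) (f (i + 1))
    ⟨hxne _, hxne _, hne, hix, hpi, hadj i, fun h => hpred ⟨hxne _, Or.inl h⟩,
      fun h => hsucc ⟨hxne _, Or.inl h⟩, hna⟩ with h | h | h
  · exact absurd ⟨hxne _, Or.inr h⟩ hpred
  · exact absurd ⟨hxne _, Or.inr h⟩ hsucc
  · exact h

/-- **Lemma 3(d),(e) of the paper.** `G` 2-connected, o-heavy and
non-Hamiltonian, `C` a longest cycle containing all heavy vertices, `R` a
component of `G - V(C)`, `f i`, `f j` distinct vertices of `C` having neighbors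
in `R`. Then `{(f i)⁻, (f i)⁺}` and `{(f j)⁻, (f j)⁺}` are Ore-edges, and at
least one of them is an actual edge of `G`. -/
theorem lemma3de {V : Type*} [Fintype V] [DecidableEq V]
    (G : SimpleGraph V) [DecidableRel G.Adj]
    (h2 : TwoConnected G) (hoh : OHeavy G)
    (hnh : ¬G.IsHamiltonian)
    (m : ℕ) (f : ZMod m → V) (hC : IsLongestCycle G m f)
    (hheavyC : ∀ x : V, Fintype.card V ≤ 2 * G.degree x → x ∈ Set.range f)
    (R : Set V) (hR : IsComponentOutside G m f R)
    (i j : ZMod m) (hij : i ≠ j)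
    (hi : ∃ x ∈ R, G.Adj (f i) x) (hj : ∃ x ∈ R, G.Adj (f j) x) :
    OreEdge G (f (i - 1)) (f (i + 1)) ∧ OreEdge G (f (j - 1)) (f (j + 1)) ∧
    (G.Adj (f (i - 1)) (f (i + 1)) ∨ G.Adj (f (j - 1)) (f (j + 1))) := by
  obtain ⟨-, hRC, hconn, -⟩ := hR
  have hi' := hi
  have hj' := hj
  obtain ⟨x, hxR, hix⟩ := hi'
  obtain ⟨y, hyR, hjy⟩ := hj'
  have hOi := hC.oreEdge_pred_succ hoh (hRC x hxR) hix
  have hOj := hC.oreEdge_pred_succ hoh (hRC y hyR) hjy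
  refine ⟨hOi, hOj, ?_⟩
  by_contra! hna
  have hdi := hOi.2.resolve_left hna.1
  have hdj := hOj.2.resolve_left hna.2
  have hinj := hC.1.2.1
  have hsucc := hC.not_oreEdge_succ_succ hRC hconn hij hi hj
  have hpred : ¬OreEdge G (f (i - 1)) (f (j - 1)) := by
    have h := hC.neg.not_oreEdge_succ_succ (i := -i) (j := -j)
      (fun z hz ⟨k, hk⟩ => hRC z hz ⟨_, hk⟩) hconn (neg_injective.ne hij)
      (by simpa using hi) (by simpa using hj)
    rwa [show -(-i + 1) = i - 1 by ring, show -(-j + 1) = j - 1 by ring] at h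
  have h1 : ¬Fintype.card V ≤ G.degree (f (i + 1)) + G.degree (f (j + 1)) := fun h =>
    hsucc ⟨hinj.ne ((add_left_injective 1).ne hij), Or.inr h⟩
  have h2 : ¬Fintype.card V ≤ G.degree (f (i - 1)) + G.degree (f (j - 1)) := fun h =>
    hpred ⟨hinj.ne ((sub_left_injective (b := (1 : ZMod m))).ne hij), Or.inr h⟩
  omega
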